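/- Let G be a simple graph with vertex set S (so that the cliques of G form a flag simplicial complex L), let (W',S') be a Coxeter system with Coxeter matrix (m'(s',t')), and let f : S → S' be a map such that for every finite clique T of G the restriction of f to T is injective and the subgroup W'_{f(T)} of W' generated by f(T) is finite. Define a Coxeter matrix (m(s,t)) over S by m(s,s) = 1, m(s,t) = m'(f(s),f(t)) if s ≠ t are adjacent in G, and m(s,t) = ∞ if s ≠ t are not adjacent in G, and let W be the associated Coxeter group. Then for every finite subset T ⊆ S, the subgroup W_T of W generated by T is finite if and only if the elements of T are pairwise adjacent in G (i.e., T is a clique of G). In other words, the nerve L(W,S) equals L. -/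

import Mathlib

open Polynomial.Chebyshev CoxeterSystem in
theorem NerveAux.rel_pow {m : ℕ} (hm : 2 ≤ m) {V : Type*} [AddCommGroup V] [Module ℝ V]
    {x y : V} {f g : Module.Dual ℝ V} (hf : f x = 2) (hg : g y = 2)
    (hfy : f y = -2 * Real.cos (Real.pi / m)) (hgx : g x = -2 * Real.cos (Real.pi / m)) :
    (Module.reflection hf * Module.reflection hg) ^ m = 1 := by
  have hm0 : (m : ℝ) ≠ 0 := by positivity
  have ht : f y * g x - 2 = 2 * Real.cos (2 * Real.pi / m) := by
    rw [hfy, hgx, mul_div_assoc, Real.cos_two_mul]; ring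
  have key := Module.reflection_mul_reflection_pow_apply hf hg m (t := 2 * Real.cos (2 * Real.pi / m))
    (ht := ht.symm)
  ext z
  rw [key z]
  rcases hm.eq_or_lt with rfl | hm3
  · have h0 : f y = 0 := by rw [hfy]; simp
    have h1 : g x = 0 := by rw [hgx]; simp
    have h2 : (2 * Real.cos (2 * Real.pi / (2:ℕ))) = -2 := by simp
    norm_num [h0, h1]
    abel
  have hsin : Real.sin (2 * Real.pi / m) ≠ 0 := by
    apply ne_of_gt
    apply Real.sin_pos_of_pos_of_lt_pi
    · have := Real.pi_pos; positivity
    · rw [div_lt_iff₀ (by positivity)]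
      have : (3 : ℝ) ≤ m := by exact_mod_cast hm3
      nlinarith [Real.pi_pos]
  rcases Nat.even_or_odd' m with ⟨j, rfl | rfl⟩
  · have e1 : (((2 * j : ℕ) : ℤ) - 2) / 2 = j - 1 := by omega
    have e2 : (((2 * j : ℕ) : ℤ) - 1) / 2 = j - 1 := by omega
    have h0 : (S ℝ ((j : ℤ) - 1)).eval (2 * Real.cos (2 * Real.pi / (2 * j : ℕ))) = 0 := by
      have := S_two_mul_real_cos (2 * Real.pi / (2 * j : ℕ)) ((j : ℤ) - 1)
      rw [show (((j : ℤ) - 1 : ℤ) + 1 : ℝ) * (2 * Real.pi / (2 * j : ℕ)) = Real.pi by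
        push_cast at hm0 ⊢
        have hj : (j : ℝ) ≠ 0 := right_ne_zero_of_mul hm0
        field_simp; ring, Real.sin_pi] at this
      exact (mul_eq_zero.mp this).resolve_right hsin
    rw [e1, e2, h0]
    simp
  · have e1 : (((2 * j + 1 : ℕ) : ℤ) - 2) / 2 = j - 1 := by omega
    have e2 : (((2 * j + 1 : ℕ) : ℤ) - 1) / 2 = j := by omega
    have e3 : (((2 * j + 1 : ℕ) : ℤ) - 3) / 2 = j - 1 := by omega
    have e4 : (((2 * j + 1 : ℕ) : ℤ)) / 2 = j := by omega
    have h0 : (S ℝ (j : ℤ)).eval (2 * Real.cos (2 * Real.pi / (2 * j + 1 : ℕ))) +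
       (S ℝ ((j : ℤ) - 1)).eval (2 * Real.cos (2 * Real.pi / (2 * j + 1 : ℕ))) = 0 := by
      have h1 := S_two_mul_real_cos (2 * Real.pi / (2 * j + 1 : ℕ)) ((j : ℤ) - 1)
      have h2 := S_two_mul_real_cos (2 * Real.pi / (2 * j + 1 : ℕ)) (j : ℤ)
      rw [show (((j : ℤ) : ℤ) + 1 : ℝ) * (2 * Real.pi / (2 * j + 1 : ℕ)) =
        2 * Real.pi - (((j : ℤ) - 1 : ℤ) + 1 : ℝ) * (2 * Real.pi / (2 * j + 1 : ℕ)) by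
        push_cast at hm0 ⊢; field_simp; ring, Real.sin_two_pi_sub] at h2
      have h3 := congrArg₂ (· + ·) h2 h1
      simp only [neg_add_cancel] at h3
      rw [← add_mul] at h3
      exact (mul_eq_zero.mp h3).resolve_right hsin
    rw [e1, e2, e3, e4, h0]
    simp

noncomputable section
namespace NerveAux
open CoxeterSystem

variable {B : Type*} (M : CoxeterMatrix B) {W : Type*} [Group W] (cs : CoxeterSystem M W)

/-- The simple coroot of `s` in the geometric representation. -/
def coroot (s : B) : Module.Dual ℝ (B →₀ ℝ) :=
  Finsupp.linearCombination ℝ (fun t => -2 * Real.cos (Real.pi / M s t))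

theorem coroot_single (s t : B) :
    coroot M s (Finsupp.single t 1) = -2 * Real.cos (Real.pi / M s t) := by
  simp [coroot]

theorem coroot_self (s : B) : coroot M s (Finsupp.single s 1) = 2 := by
  rw [coroot_single]; simp

/-- The simple reflection. -/
def refl (s : B) : (B →₀ ℝ) ≃ₗ[ℝ] (B →₀ ℝ) := Module.reflection (coroot_self M s)

theorem refl_apply (s : B) (v : B →₀ ℝ) :
    refl M s v = v - coroot M s v • Finsupp.single s 1 := Module.reflection_apply _ _

theorem liftable : M.IsLiftable (refl M) := by
  intro s t
  by_cases hst : s = t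
  · subst hst
    rw [M.diagonal, pow_one]
    ext1 v
    exact Module.involutive_reflection (coroot_self M s) v
  · rcases Nat.eq_zero_or_pos (M s t) with h0 | h0
    · rw [h0, pow_zero]
    have h1 := M.off_diagonal s t hst
    refine rel_pow (by omega) _ _ (coroot_single M s t) ?_
    rw [coroot_single, M.symmetric]

variable {M}

/-- The geometric representation. -/
def rep : W →* ((B →₀ ℝ) ≃ₗ[ℝ] (B →₀ ℝ)) := cs.lift ⟨refl M, liftable M⟩

theorem rep_simple (s : B) : rep cs (cs.simple s) = refl M s :=
  cs.lift_apply_simple (liftable M) s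

/-- Chebyshev coefficients. -/
def cf (c : ℝ) (k : ℤ) : ℝ := (Polynomial.Chebyshev.S ℝ k).eval c

theorem cf_succ (c : ℝ) (k : ℕ) : cf c ((k + 1 : ℕ) : ℤ) = c * cf c k - cf c ((k : ℤ) - 1) := by
  have := Polynomial.Chebyshev.S_add_one ℝ (k : ℤ)
  simp [cf, this]

theorem cf_zero (c : ℝ) : cf c 0 = 1 := by simp [cf]
theorem cf_neg_one (c : ℝ) : cf c (-1) = 0 := by simp [cf]

theorem rep_alt (s t : B) (k : ℕ) :
    rep cs (cs.wordProd (alternatingWord s t k)) (Finsupp.single s 1) =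
      if Even k then
        cf (2 * Real.cos (Real.pi / M s t)) k • Finsupp.single s (1 : ℝ) +
        cf (2 * Real.cos (Real.pi / M s t)) (k - 1) • Finsupp.single t (1 : ℝ)
      else
        cf (2 * Real.cos (Real.pi / M s t)) (k - 1) • Finsupp.single s (1 : ℝ) +
        cf (2 * Real.cos (Real.pi / M s t)) k • Finsupp.single t (1 : ℝ) := by
  induction k with
  | zero => simp [alternatingWord, cf_zero, cf_neg_one]
  | succ k ih =>
    rw [alternatingWord_succ', wordProd_cons, map_mul, LinearEquiv.mul_apply, ih, rep_simple,
      refl_apply, cf_succ]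
    have hst := coroot_single M s t
    have hts := coroot_single M t s
    rw [M.symmetric t s] at hts
    have e : (((k + 1 : ℕ) : ℤ) - 1) = k := by push_cast; ring
    rw [e]
    by_cases hk : Even k
    · have hk' : ¬ Even (k + 1) := by simp [hk, parity_simps]
      simp only [hk, hk', if_true, if_false, map_add, map_smul, coroot_self, hts, smul_eq_mul]
      module
    · have hk' : Even (k + 1) := by simp [hk, parity_simps]
      simp only [hk, hk', if_true, if_false, map_add, map_smul, coroot_self, hst, smul_eq_mul]
      module

theorem cf_two (k : ℕ) : cf 2 k = k + 1 := by
  simp [cf]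

theorem cf_nonneg (m k : ℕ) (hm1 : m ≠ 1) (h : m = 0 ∨ k < m) :
    0 ≤ cf (2 * Real.cos (Real.pi / m)) k := by
  rcases Nat.eq_zero_or_pos m with rfl | hm
  · simp only [Nat.cast_zero, div_zero, Real.cos_zero, mul_one, cf_two]; positivity
  have hk : k < m := by omega
  have hm2 : 2 ≤ m := by omega
  have hm2' : (2 : ℝ) ≤ m := by exact_mod_cast hm2
  have hk' : (k : ℝ) + 1 ≤ m := by exact_mod_cast hk
  have hpi := Real.pi_pos
  have hsin : 0 < Real.sin (Real.pi / m) := by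
    apply Real.sin_pos_of_pos_of_lt_pi
    · positivity
    · rw [div_lt_iff₀ (by positivity)]
      nlinarith
  have := Polynomial.Chebyshev.S_two_mul_real_cos (Real.pi / m) (k : ℤ)
  have h2 : 0 ≤ Real.sin (((k : ℤ) + 1 : ℝ) * (Real.pi / m)) := by
    apply Real.sin_nonneg_of_nonneg_of_le_pi
    · push_cast; positivity
    · rw [← mul_div_assoc, div_le_iff₀ (by positivity)]
      push_cast
      nlinarith
  rw [← this] at h2
  exact nonneg_of_mul_nonneg_left h2 hsin

theorem cf_nonneg' (m k : ℕ) (hm1 : m ≠ 1) (h : m = 0 ∨ k < m) :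
    0 ≤ cf (2 * Real.cos (Real.pi / m)) ((k : ℤ) - 1) := by
  cases k with
  | zero => simp [cf_neg_one]
  | succ k =>
    have := cf_nonneg m k hm1 (by omega)
    simpa using this

theorem rep_nonneg (n : ℕ) : ∀ (w : W) (s : B), cs.length w = n → ¬ cs.IsRightDescent w s →
    0 ≤ rep cs w (Finsupp.single s 1) := by
  induction n using Nat.strong_induction_on with
  | _ n ih =>
  intro w s hn hs
  by_cases hw : w = 1
  · subst hw
    simp
  obtain ⟨t, ht⟩ := cs.exists_rightDescent_of_ne_one hw
  have hst : s ≠ t := by rintro rfl; exact hs ht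
  have hm1 := M.off_diagonal s t hst
  let P : ℕ → Prop := fun k =>
    cs.length (w * (cs.wordProd (alternatingWord s t k))⁻¹) + k = cs.length w
  have hP1 : P 1 := by
    have := cs.isRightDescent_iff.mp ht
    simpa [P, alternatingWord] using this
  obtain ⟨k, hk, hk1, hkmax⟩ : ∃ k, P k ∧ 1 ≤ k ∧ ¬ P (k + 1) := by
    classical
    have hb : 1 ≤ cs.length w := by have : _ + 1 = _ := hP1; omega
    refine ⟨Nat.findGreatest P (cs.length w), Nat.findGreatest_spec hb hP1,
      Nat.le_findGreatest hb hP1, fun h => ?_⟩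
    have h2 : _ + _ = _ := h
    have := Nat.le_findGreatest (P := P) (n := cs.length w) (by omega) h
    omega
  obtain ⟨v, hv⟩ : ∃ v, v = w * (cs.wordProd (alternatingWord s t k))⁻¹ := ⟨_, rfl⟩
  have hwv : w = v * cs.wordProd (alternatingWord s t k) := by rw [hv]; group
  have hk' : cs.length v + k = cs.length w := by rw [hv]; exact hk
  have hy : ¬ cs.IsRightDescent v (if Even k then t else s) := by
    intro h
    apply hkmax
    have h := cs.isRightDescent_iff.mp h
    simp only [P]
    rw [alternatingWord_succ', wordProd_cons, mul_inv_rev, inv_simple, ← mul_assoc, ← hv]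
    omega
  have hx : ¬ cs.IsRightDescent v (if Even k then s else t) := by
    intro h
    have h := cs.isRightDescent_iff.mp h
    obtain ⟨j, rfl⟩ : ∃ j, k = j + 1 := ⟨k - 1, by omega⟩
    have e : (if Even (j + 1) then s else t) = (if Even j then t else s) := by
      by_cases hj : Even j <;> simp [hj, parity_simps]
    rw [e] at h
    rw [alternatingWord_succ', wordProd_cons, ← mul_assoc] at hwv
    have h3 := cs.length_mul_le (v * cs.simple (if Even j then t else s))
      (cs.wordProd (alternatingWord s t j))
    rw [← hwv] at h3
    have h4 := cs.length_wordProd_le (alternatingWord s t j)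
    rw [length_alternatingWord] at h4
    omega
  have hvs : ¬ cs.IsRightDescent v s := by
    by_cases h : Even k
    · simpa [h] using hx
    · simpa [h] using hy
  have hvt : ¬ cs.IsRightDescent v t := by
    by_cases h : Even k
    · simpa [h] using hy
    · simpa [h] using hx
  have hkm : M s t = 0 ∨ k < M s t := by
    by_contra! hcon
    obtain ⟨h0, h1⟩ := hcon
    have h2 := cs.not_isRightDescent_iff.mp hs
    have h3 : w * cs.simple s = v * cs.wordProd (alternatingWord t s (k + 1)) := by
      rw [alternatingWord_succ, wordProd_concat, hwv, mul_assoc]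
    have h4 := cs.length_mul_le v (cs.wordProd (alternatingWord t s (k + 1)))
    rw [← h3] at h4
    have h5 := cs.length_wordProd_le (alternatingWord t s (k + 1))
    rw [length_alternatingWord] at h5
    refine cs.not_isReduced_alternatingWord t s (m := k + 1) ?_ ?_ ?_
    · rwa [M.symmetric]
    · rw [M.symmetric]; omega
    · rw [CoxeterSystem.IsReduced, length_alternatingWord]; omega
  have i1 := ih (cs.length v) (by omega) v s rfl hvs
  have i2 := ih (cs.length v) (by omega) v t rfl hvt
  have c1 := cf_nonneg (M s t) k hm1 hkm
  have c2 := cf_nonneg' (M s t) k hm1 hkm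
  rw [hwv, map_mul, LinearEquiv.mul_apply, rep_alt]
  split_ifs
  · rw [map_add, map_smul, map_smul]
    exact add_nonneg (smul_nonneg c1 i1) (smul_nonneg c2 i2)
  · rw [map_add, map_smul, map_smul]
    exact add_nonneg (smul_nonneg c2 i1) (smul_nonneg c1 i2)

theorem rep_injective : Function.Injective (rep cs) := by
  rw [injective_iff_map_eq_one]
  intro w hw
  by_contra h
  obtain ⟨s, hs⟩ := cs.exists_rightDescent_of_ne_one h
  have h1 := rep_nonneg cs _ (w * cs.simple s) s rfl
    (cs.isRightDescent_iff_not_isRightDescent_mul.mp hs)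
  rw [map_mul, hw, one_mul, rep_simple, refl_apply, coroot_self] at h1
  have := h1 s
  norm_num at this

theorem infinite_order (s t : B) (hst : s ≠ t) (h : M s t = 0) :
    ¬ IsOfFinOrder (cs.simple s * cs.simple t) := by
  rw [isOfFinOrder_iff_pow_eq_one]
  rintro ⟨n, hn, h1⟩
  have h2 := rep_alt cs s t (2 * n)
  rw [prod_alternatingWord_eq_mul_pow] at h2
  simp only [even_two, Even.mul_right, if_true, one_mul] at h2
  rw [Nat.mul_div_cancel_left _ (by norm_num), h1, h] at h2
  have h3 := DFunLike.congr_fun h2 s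
  simp only [Nat.cast_zero, div_zero, Real.cos_zero, mul_one, cf_two] at h3
  simp [hst] at h3
  omega

theorem parabolic_injective {B' W' : Type*} [Group W'] {M' : CoxeterMatrix B'}
    (cs' : CoxeterSystem M' W') (j : B → B') (hj : Function.Injective j)
    (φ : W →* W') (hφ : ∀ s, φ (cs.simple s) = cs'.simple (j s))
    (hM : ∀ s t, M s t = M' (j s) (j t)) : Function.Injective φ := by
  have key : ∀ w : W, ∀ v, rep cs' (φ w) (Finsupp.lmapDomain ℝ ℝ j v) =
      Finsupp.lmapDomain ℝ ℝ j (rep cs w v) := by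
    intro w
    induction w using cs.simple_induction with
    | one => simp
    | mul a b ha hb => 
      intro v
      rw [map_mul, map_mul, map_mul, LinearEquiv.mul_apply, LinearEquiv.mul_apply, hb, ha]
    | simple s =>
      intro v
      rw [hφ, rep_simple, rep_simple, refl_apply, refl_apply, map_sub, map_smul]
      congr 2
      · have : coroot M' (j s) ∘ₗ Finsupp.lmapDomain ℝ ℝ j = coroot M s := by
          ext t
          simp [coroot, hM]
        rw [← this]; rfl
      · simp
  rw [injective_iff_map_eq_one]
  intro w hw
  apply rep_injective cs
  rw [map_one]
  ext1 v
  apply Finsupp.mapDomain_injective hj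
  have := key w v
  rw [hw, map_one] at this
  exact this.symm

/-- Restriction of a Coxeter matrix. -/
def restrict (M : CoxeterMatrix B) (T : Set B) : CoxeterMatrix T where
  M := Matrix.of fun s t => M s t
  isSymm := by ext s t; exact M.symmetric _ _
  diagonal s := M.diagonal s
  off_diagonal s t h := M.off_diagonal s t (fun h' => h (Subtype.ext h'))

theorem restrict_apply (M : CoxeterMatrix B) (T : Set B) (s t : T) :
    restrict M T s t = M s t := rfl

end NerveAux
end

/-- Let `G` be a simple graph on `S` (whose cliques form a flag complex `L`),
`(W', S')` a Coxeter system with Coxeter matrix `M'`, and `f : S → S'` a map such that for every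
finite clique `T` of `G`, `f` is injective on `T` and the special subgroup of `W'` generated by
the simple reflections indexed by `f(T)` is finite.  Let `M` be the Coxeter matrix over `S` with
`M s t = M' (f s) (f t)` for adjacent `s ≠ t` and `M s t = ∞` (encoded as `0`) for non-adjacent
`s ≠ t`, and let `(W, S)` be the associated Coxeter system.  Then a finite subset `T ⊆ S` is
spherical in `W` (i.e. generates a finite subgroup) if and only if `T` is a clique of `G`;
in other words the nerve `L(W,S)` equals `L`. -/
theorem nerve_eq_flag_complex {S S' : Type*} (G : SimpleGraph S)
    {W W' : Type*} [Group W] [Group W']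
    {M' : CoxeterMatrix S'} (cs' : CoxeterSystem M' W')
    (f : S → S')
    (hf : ∀ T : Finset S, G.IsClique (T : Set S) →
      Set.InjOn f (T : Set S) ∧
        Finite ↥(Subgroup.closure (cs'.simple '' (f '' (T : Set S)))))
    {M : CoxeterMatrix S}
    (hM_adj : ∀ s t : S, s ≠ t → G.Adj s t → M s t = M' (f s) (f t))
    (hM_nonadj : ∀ s t : S, s ≠ t → ¬ G.Adj s t → M s t = 0)
    (cs : CoxeterSystem M W) :
    ∀ T : Finset S,
      Finite ↥(Subgroup.closure (cs.simple '' (T : Set S))) ↔ G.IsClique (T : Set S) := by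
  open NerveAux in
  intro T
  constructor
  · intro hfin s hs t ht hst
    by_contra hadj
    have h1 := infinite_order cs s t hst (hM_nonadj s t hst hadj)
    let H := Subgroup.closure (cs.simple '' (T : Set S))
    have hs' : cs.simple s ∈ H := Subgroup.subset_closure ⟨s, hs, rfl⟩
    have ht' : cs.simple t ∈ H := Subgroup.subset_closure ⟨t, ht, rfl⟩
    have : Finite H := hfin
    have h2 := isOfFinOrder_of_finite (⟨_, H.mul_mem hs' ht'⟩ : H)
    exact h1 (Submonoid.isOfFinOrder_coe.mpr h2)
  · intro hT
    obtain ⟨hinj, hfin⟩ := hf T hT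
    let N := restrict M (T : Set S)
    let cN := N.toCoxeterSystem
    have hN : ∀ s t : (T : Set S), N s t = M' (f s) (f t) := by
      intro s t
      by_cases hst : s = t
      · subst hst; rw [N.diagonal, M'.diagonal]
      · have hne : (s : S) ≠ t := fun h => hst (Subtype.ext h)
        exact hM_adj s t hne (hT s.2 t.2 hne)
    have l1 : N.IsLiftable (fun s : (T : Set S) => cs.simple s) := fun s t =>
      cs.simple_mul_simple_pow (s : S) t
    have l2 : N.IsLiftable (fun s : (T : Set S) => cs'.simple (f s)) := fun s t => by
      rw [hN]; exact cs'.simple_mul_simple_pow _ _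
    let φ : N.Group →* W := cN.lift ⟨_, l1⟩
    let ψ : N.Group →* W' := cN.lift ⟨_, l2⟩
    have hφ : ∀ s, φ (cN.simple s) = cs.simple s := cN.lift_apply_simple l1
    have hψ : ∀ s, ψ (cN.simple s) = cs'.simple (f s) := cN.lift_apply_simple l2
    have hψinj : Function.Injective ψ :=
      parabolic_injective cN cs' (fun s : (T : Set S) => f s)
        (fun a b h => Subtype.ext (hinj a.2 b.2 h)) ψ hψ hN
    have hmem : ∀ w, ψ w ∈ Subgroup.closure (cs'.simple '' (f '' (T : Set S))) := by
      intro w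
      induction w using cN.simple_induction with
      | one => rw [map_one]; exact one_mem _
      | mul a b ha hb => rw [map_mul]; exact mul_mem ha hb
      | simple s =>
        rw [hψ]; exact Subgroup.subset_closure ⟨_, ⟨s, s.2, rfl⟩, rfl⟩
    have hfinN : Finite N.Group :=
      Finite.of_injective (fun w => (⟨ψ w, hmem w⟩ :
        Subgroup.closure (cs'.simple '' (f '' (T : Set S)))))
        (fun a b h => hψinj (congrArg Subtype.val h))
    have hle : Subgroup.closure (cs.simple '' (T : Set S)) ≤ φ.range := by
      rw [Subgroup.closure_le]
      rintro _ ⟨s, hs, rfl⟩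
      exact ⟨cN.simple ⟨s, hs⟩, hφ ⟨s, hs⟩⟩
    have : Finite φ.range := Set.finite_range φ
    exact Finite.of_injective _ (Subgroup.inclusion_injective hle)
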